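/- arXiv:2112.06980 — 3 statements merged into one kernel-verified Lean document; each statement's English description precedes it below -/
import Mathlib

section
/- Let n ≥ 1 and let r be a natural number with r ≥ (n+3 choose 3)/(3n+1) + 1 (floor division). Then generic complex r-identifiability of the cubic Chow decomposition in n+1 variables fails: for every nonzero polynomial P ∈ MvPolynomial (Fin r × Fin 3 × Fin (n+1)) ℂ there exist parameter tuples A, B : Fin r → Fin 3 → (Fin (n+1) → ℂ) such that P evaluates to a nonzero value at A, Φ(A) = Φ(B), and yet M(A) ≠ M(B). -/
/-- The linear form `ℓ_a = ∑ i, a i • X i` in `n+1` variables. -/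
noncomputable def linForm (n : ℕ) (a : Fin (n + 1) → ℂ) : MvPolynomial (Fin (n + 1)) ℂ :=
  ∑ i, a i • MvPolynomial.X i

/-- The cubic `Φ(A) = ∑ j, ∏ i, ℓ_{A j i}` determined by the parameter tuple `A`. -/
noncomputable def chowPhi (n r : ℕ) (A : Fin r → Fin 3 → (Fin (n + 1) → ℂ)) :
    MvPolynomial (Fin (n + 1)) ℂ :=
  ∑ j, ∏ i, linForm n (A j i)

/-- The multiset `M(A)` of the `r` completely decomposable cubic summands. -/
noncomputable def chowSummands (n r : ℕ) (A : Fin r → Fin 3 → (Fin (n + 1) → ℂ)) :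
    Multiset (MvPolynomial (Fin (n + 1)) ℂ) :=
  Multiset.map (fun j => ∏ i, linForm n (A j i)) (Finset.univ.val : Multiset (Fin r))

namespace MvPolynomial

/-- The ideals of any two points of affine space have the same height, as they are exchanged by a
translation. -/
theorem height_vanishingIdeal_singleton_eq {K σ : Type*} [Field K] (x y : σ → K) :
    (vanishingIdeal K {x}).height = (vanishingIdeal K {y}).height := by
  let e : MvPolynomial σ K ≃ₐ[K] MvPolynomial σ K :=
    AlgEquiv.ofAlgHom (aeval fun i => X i + C (x i - y i)) (aeval fun i => X i + C (y i - x i))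
      (by ext1 i; simp [algebraMap_eq]; ring) (by ext1 i; simp [algebraMap_eq]; ring)
  have h : (vanishingIdeal K {x}).comap e.symm.toRingEquiv = vanishingIdeal K {y} := by
    ext p
    have : (aeval x).comp (e.symm : MvPolynomial σ K →ₐ[K] MvPolynomial σ K) = aeval y := by
      ext i
      simp [e]
    simpa using congrArg (· = 0) (DFunLike.congr_fun this p)
  rw [← h, RingEquiv.height_comap]

/-- The height of the ideal of a point in affine space is at least the number of variables. -/
theorem card_le_height_vanishingIdeal_singleton {K σ : Type*} [Field K] [IsAlgClosed K] [Fintype σ]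
    (x : σ → K) : (Fintype.card σ : ℕ∞) ≤ (vanishingIdeal K {x}).height := by
  have h₁ : ((Fintype.card σ : ℕ∞) : WithBot ℕ∞) ≤ ringKrullDim (MvPolynomial σ K) := by
    simp
  rw [← Ideal.sup_isMaximal_height_eq_ringKrullDim, WithBot.coe_le_coe] at h₁
  refine h₁.trans (iSup₂_le fun I hI => ?_)
  obtain ⟨y, rfl⟩ := isMaximal_iff_eq_vanishingIdeal_singleton.1 hI
  exact (height_vanishingIdeal_singleton_eq y x).le

/-- A nonempty affine algebraic set over an algebraically closed field that is cut out by fewer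
equations than there are variables is infinite. -/
theorem infinite_setOf_forall_eval_eq_zero {K σ : Type*} [Field K] [IsAlgClosed K] [Fintype σ]
    (s : Finset (MvPolynomial σ K)) (hs : s.card < Fintype.card σ) {a : σ → K}
    (ha : ∀ f ∈ s, eval a f = 0) : {x : σ → K | ∀ f ∈ s, eval x f = 0}.Infinite := by
  intro hfin
  have hle : Ideal.span (s : Set (MvPolynomial σ K)) ≤ vanishingIdeal K {a} :=
    Ideal.span_le.2 fun f hf => by simpa [coe_aeval_eq_eval] using ha f hf
  obtain ⟨p, hp, -⟩ := Ideal.exists_minimalPrimes_le hle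
  have hprime : p.IsPrime := hp.1.1
  have hsub : zeroLocus K p ⊆ {x | ∀ f ∈ s, eval x f = 0} := fun x hx f hf => by
    simpa [coe_aeval_eq_eval] using hx f (hp.1.2 (Ideal.subset_span hf))
  have hZ : (zeroLocus K p).Finite := hfin.subset hsub
  have hinf : hZ.toFinset.inf (fun x => vanishingIdeal K {x}) ≤ p := by
    conv_rhs => rw [← IsPrime.vanishingIdeal_zeroLocus (K := K) p]
    intro f hf x hx
    rw [Submodule.mem_finsetInf] at hf
    exact hf x (by simpa using hx) x rfl
  obtain ⟨x, -, hx⟩ := hprime.inf_le'.1 hinf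
  have hxp : vanishingIdeal K {x} = p := Ideal.IsMaximal.eq_of_le inferInstance hprime.ne_top hx
  have h₁ := Ideal.height_le_card_of_mem_minimalPrimes_span_finset hp
  rw [← hxp] at h₁
  have h₂ := (card_le_height_vanishingIdeal_singleton x).trans h₁
  exact absurd (by exact_mod_cast h₂) hs.not_ge

end MvPolynomial

open MvPolynomial

theorem coeff_linForm (n : ℕ) (a : Fin (n + 1) → ℂ) (k : Fin (n + 1)) :
    coeff (Finsupp.single k 1) (linForm n a) = a k := by
  simp [linForm, coeff_sum, coeff_X, Finsupp.single_left_inj]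

theorem linForm_injective (n : ℕ) : Function.Injective (linForm n) := fun a b h => by
  ext k
  rw [← coeff_linForm n a, h, coeff_linForm]

theorem linForm_ne_zero {n : ℕ} {a : Fin (n + 1) → ℂ} {k : Fin (n + 1)} (h : a k ≠ 0) :
    linForm n a ≠ 0 := fun h0 => h (by rw [← coeff_linForm n a, h0, coeff_zero])

theorem isHomogeneous_linForm (n : ℕ) (a : Fin (n + 1) → ℂ) : (linForm n a).IsHomogeneous 1 :=
  IsHomogeneous.sum _ _ _ fun i _ => by
    rw [smul_eq_C_mul]
    exact (isHomogeneous_X ℂ i).C_mul (a i)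

theorem isHomogeneous_chowPhi (n r : ℕ) (A : Fin r → Fin 3 → (Fin (n + 1) → ℂ)) :
    (chowPhi n r A).IsHomogeneous 3 :=
  IsHomogeneous.sum _ _ _ fun j _ => by
    simpa using IsHomogeneous.prod Finset.univ (fun i => linForm n (A j i)) (fun _ => 1)
      fun i _ => isHomogeneous_linForm n (A j i)

/-- A nonzero polynomial has finitely many linear divisors with prescribed nonzero leading
coefficient. -/
theorem finite_setOf_linForm_dvd {n : ℕ} {q : MvPolynomial (Fin (n + 1)) ℂ} (hq : q ≠ 0)
    {c : ℂ} (hc : c ≠ 0) : {a : Fin (n + 1) → ℂ | linForm n a ∣ q ∧ a 0 = c}.Finite := by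
  have hfin : {x : Associates (MvPolynomial (Fin (n + 1)) ℂ) | x ∣ Associates.mk q}.Finite := by
    let := UniqueFactorizationMonoid.fintypeSubtypeDvd (Associates.mk q)
      (Associates.mk_ne_zero.2 hq)
    exact Set.finite_coe_iff.1 (Finite.of_fintype {x // x ∣ Associates.mk q})
  refine Set.Finite.of_injOn (f := fun a => Associates.mk (linForm n a))
    (fun a ha => Associates.mk_dvd_mk.2 ha.1) ?_ hfin
  rintro a ⟨-, ha⟩ b ⟨-, hb⟩ hab
  obtain ⟨u, hu⟩ := Associates.mk_eq_mk_iff_associated.1 hab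
  obtain ⟨z, -, hz⟩ := MvPolynomial.isUnit_iff_eq_C_of_isReduced.1 u.isUnit
  rw [hz, mul_comm] at hu
  have h₀ := congrArg (coeff (Finsupp.single 0 1)) hu
  rw [coeff_C_mul, coeff_linForm, coeff_linForm, ha, hb] at h₀
  rw [mul_eq_right₀ hc] at h₀
  apply linForm_injective
  simpa [h₀] using hu

/-- The tuples that share with `A` the leading coefficient of the second and third linear factor of
each summand, parametrized by their remaining `r * (3 * n + 1)` coefficients. -/
def normalizedTuple {R : Type*} {n r : ℕ} (A : Fin r → Fin 3 → Fin (n + 1) → R)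
    (y : Fin r × Option (Fin 3 × Fin n) → R) : Fin r → Fin 3 → Fin (n + 1) → R :=
  fun j i => Fin.cons (if i = 0 then y (j, none) else A j i 0) fun k => y (j, some (i, k))

theorem normalizedTuple_self {R : Type*} {n r : ℕ} (A : Fin r → Fin 3 → Fin (n + 1) → R) :
    normalizedTuple A (fun x => x.2.elim (A x.1 0 0) fun z => A x.1 z.1 z.2.succ) = A := by
  ext j i k
  refine Fin.cases ?_ (fun k => ?_) k
  · by_cases hi : i = 0 <;> simp [normalizedTuple, hi]
  · simp [normalizedTuple]

theorem normalizedTuple_injective {R : Type*} {n r : ℕ} (A : Fin r → Fin 3 → Fin (n + 1) → R) :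
    Function.Injective (normalizedTuple A) := by
  rintro y z h
  ext ⟨j, _ | ⟨i, k⟩⟩
  · simpa [normalizedTuple] using congrFun₃ h j 0 0
  · simpa [normalizedTuple] using congrFun₃ h j i k.succ

theorem exists_eval_eq_coeff_chowPhi {n r : ℕ} (A : Fin r → Fin 3 → Fin (n + 1) → ℂ)
    (d : Fin (n + 1) →₀ ℕ) : ∃ F : MvPolynomial (Fin r × Option (Fin 3 × Fin n)) ℂ,
      ∀ y, eval y F = coeff d (chowPhi n r (normalizedTuple A y)) := by
  refine ⟨coeff d (∑ j, ∏ i, ∑ k,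
    C (normalizedTuple (fun j i k => C (A j i k)) X j i k) * X k), fun y => ?_⟩
  rw [← coeff_map]
  congr 1
  simp only [chowPhi, linForm, map_sum, map_prod, map_mul, map_C, map_X, smul_eq_C_mul]
  congr! 7 with j _ i _ k
  refine Fin.cases ?_ (fun k => ?_) k
  · by_cases hi : i = 0 <;> simp [normalizedTuple, hi]
  · simp [normalizedTuple]

theorem infinite_setOf_chowPhi_eq {n r : ℕ} (A : Fin r → Fin 3 → Fin (n + 1) → ℂ)
    (hr : (n + 3).choose 3 < r * (3 * n + 1)) :
    {y | chowPhi n r (normalizedTuple A y) = chowPhi n r A}.Infinite := by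
  classical
  choose F hF using exists_eval_eq_coeff_chowPhi A
  let s := (Finset.univ.finsuppAntidiag 3).image fun d => F d - C (coeff d (chowPhi n r A))
  have hs : s.card < Fintype.card (Fin r × Option (Fin 3 × Fin n)) := by
    refine Finset.card_image_le.trans_lt ?_
    rw [Finset.card_finsuppAntidiag_nat_eq_choose]
    simpa using hr
  have key := infinite_setOf_forall_eval_eq_zero s hs
    (a := fun x => x.2.elim (A x.1 0 0) fun z => A x.1 z.1 z.2.succ) (by
      simp [s, hF, normalizedTuple_self])
  refine key.mono fun y hy => ?_
  ext d
  by_cases hd : d.degree = 3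
  · have hmem : d ∈ Finset.univ.finsuppAntidiag 3 := by
      simpa [Finset.mem_finsuppAntidiag, ← Finsupp.degree_eq_sum] using hd
    simpa [hF, sub_eq_zero] using hy _ (Finset.mem_image_of_mem _ hmem)
  · rw [(isHomogeneous_chowPhi n r _).coeff_eq_zero hd,
      (isHomogeneous_chowPhi n r _).coeff_eq_zero hd]

theorem mem_chowSummands {n r : ℕ} {A : Fin r → Fin 3 → Fin (n + 1) → ℂ}
    {q : MvPolynomial (Fin (n + 1)) ℂ} :
    q ∈ chowSummands n r A ↔ ∃ j, ∏ i, linForm n (A j i) = q := by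
  simp [chowSummands]

theorem finite_setOf_chowSummands_eq {n r : ℕ} {A : Fin r → Fin 3 → Fin (n + 1) → ℂ}
    (hA : ∀ j i, A j i 0 ≠ 0) :
    {y | chowSummands n r (normalizedTuple A y) = chowSummands n r A}.Finite := by
  let S : Set (MvPolynomial (Fin (n + 1)) ℂ) := Set.range fun j => ∏ i, linForm n (A j i)
  have hS : ∀ q ∈ S, q ≠ 0 := by
    rintro _ ⟨j, rfl⟩
    exact Finset.prod_ne_zero_iff.2 fun i _ => linForm_ne_zero (hA j i)
  let D (j : Fin r) (i : Fin 3) : Set (Fin (n + 1) → ℂ) :=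
    ⋃ q ∈ S, {a | linForm n a ∣ q ∧ a 0 = A j i 0}
  have hD (j i) : (D j i).Finite :=
    (Set.finite_range _).biUnion fun q hq => finite_setOf_linForm_dvd (hS q hq) (hA j i)
  refine Set.Finite.of_injOn
    (t := Set.univ.pi fun j => S ×ˢ D j 1 ×ˢ D j 2)
    (f := fun y j => (∏ i, linForm n (normalizedTuple A y j i),
      normalizedTuple A y j 1, normalizedTuple A y j 2)) ?_ ?_
    (Set.Finite.pi fun j => (Set.finite_range _).prod ((hD j 1).prod (hD j 2)))
  · intro y hy j _
    have hmem : ∏ i, linForm n (normalizedTuple A y j i) ∈ S := by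
      have h := mem_chowSummands (A := normalizedTuple A y).2 ⟨j, rfl⟩
      rw [hy] at h
      exact mem_chowSummands.1 h
    have hmemD (i : Fin 3) (hi : i ≠ 0) : normalizedTuple A y j i ∈ D j i :=
      Set.mem_biUnion hmem
        ⟨Finset.dvd_prod_of_mem _ (Finset.mem_univ i), by simp [normalizedTuple, hi]⟩
    exact ⟨hmem, hmemD 1 (by decide), hmemD 2 (by decide)⟩
  · intro y _ z _ hyz
    apply normalizedTuple_injective A
    have hne (i : Fin 3) (hi : i ≠ 0) (j) : linForm n (normalizedTuple A z j i) ≠ 0 :=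
      linForm_ne_zero (k := 0) (by simpa [normalizedTuple, hi] using hA j i)
    ext1 j
    obtain ⟨hprod, h₁, h₂⟩ : _ ∧ _ ∧ _ := by simpa only [Prod.mk.injEq] using congrFun hyz j
    rw [Fin.prod_univ_three, Fin.prod_univ_three, h₁, h₂] at hprod
    have h₀ := linForm_injective n <| mul_right_cancel₀ (hne 1 (by decide) j) <|
      mul_right_cancel₀ (hne 2 (by decide) j) hprod
    ext1 i
    fin_cases i
    exacts [h₀, h₁, h₂]

/-- Generic complex `r`-identifiability fails once `r ≥ ⌊(n+3 choose 3)/(3n+1)⌋ + 1`. -/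
theorem chow_generic_identifiability_fails (n r : ℕ) (hn : 1 ≤ n)
    (hrank : Nat.choose (n + 3) 3 / (3 * n + 1) + 1 ≤ r) :
    ∀ P : MvPolynomial (Fin r × Fin 3 × Fin (n + 1)) ℂ, P ≠ 0 →
      ∃ A B : Fin r → Fin 3 → (Fin (n + 1) → ℂ),
        MvPolynomial.eval (fun x => A x.1 x.2.1 x.2.2) P ≠ 0 ∧
        chowPhi n r A = chowPhi n r B ∧
        chowSummands n r A ≠ chowSummands n r B := by
  intro P hP
  have hr : (n + 3).choose 3 < r * (3 * n + 1) :=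
    Nat.lt_mul_of_div_lt hrank (by positivity)
  have hQ : P * ∏ j : Fin r, ∏ i : Fin 3, X (j, i, 0) ≠ 0 :=
    mul_ne_zero hP <| Finset.prod_ne_zero_iff.2 fun j _ =>
      Finset.prod_ne_zero_iff.2 fun i _ => X_ne_zero _
  obtain ⟨a, ha⟩ : ∃ a, eval a (P * ∏ j : Fin r, ∏ i : Fin 3, X (j, i, 0)) ≠ 0 := by
    contrapose! hQ
    exact MvPolynomial.funext fun a => by simpa using hQ a
  simp only [map_mul, map_prod, eval_X, mul_ne_zero_iff, Finset.prod_ne_zero_iff,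
    Finset.mem_univ, true_imp_iff] at ha
  let A : Fin r → Fin 3 → Fin (n + 1) → ℂ := fun j i k => a (j, i, k)
  obtain ⟨y, hy, hy'⟩ := (infinite_setOf_chowPhi_eq A hr).exists_notMem_finite
    (finite_setOf_chowSummands_eq (A := A) ha.2)
  exact ⟨A, normalizedTuple A y, ha.1, hy.symm, fun h => hy' h.symm⟩
end

section
/- For every natural number n ≥ 1, the number 3n+1 divides the binomial coefficient (n+3 choose 3) if and only if n = 1 or n = 3 or n = 13. (These are exactly the perfect cases where (1/(3n+1))·(n+3 choose 3) is an integer.) -/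
/-- `3n+1` divides `(n+3 choose 3)` exactly in the perfect cases `n = 1, 3, 13`. -/
theorem chow_perfect_cases (n : ℕ) (hn : 1 ≤ n) :
    (3 * n + 1) ∣ Nat.choose (n + 3) 3 ↔ n = 1 ∨ n = 3 ∨ n = 13 := by
  constructor
  · intro h
    have h6 : 6 * (n + 3).choose 3 = (n + 3) * (n + 2) * (n + 1) := by
      have := Nat.descFactorial_eq_factorial_mul_choose (n + 3) 3
      simp only [Nat.descFactorial, Nat.factorial] at this
      norm_num at this
      rw [← this, show n + 3 - 2 = n + 1 by omega]
      ring
    have hmul : 3 * n + 1 ∣ 27 * ((n + 3) * (n + 2) * (n + 1)) := by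
      rw [← h6]
      exact Dvd.dvd.mul_left (Dvd.dvd.mul_left h 6) 27
    have hexp : 27 * ((n + 3) * (n + 2) * (n + 1)) =
        (3 * n + 1) * (9 * n ^ 2 + 51 * n + 82) + 80 := by ring
    rw [hexp, Nat.dvd_add_right (Dvd.intro _ rfl)] at hmul
    have hle : n ≤ 26 := by have := Nat.le_of_dvd (by norm_num) hmul; omega
    interval_cases n <;> omega
  · rintro (rfl | rfl | rfl) <;> decide
end

section
/- Let d and n be natural numbers with 1 ≤ d ≤ n+1. In MvPolynomial (Fin (n+1)) ℂ, consider the finite set of monomials T := { X i · ∏_{α : Fin d, α ≠ k} X (ι α) : k ∈ Fin d, i ∈ Fin (n+1) }, where ι : Fin d → Fin (n+1) is the canonical embedding. Then the ℂ-linear span of T has dimension (finrank) equal to d·n + 1. (This is the dimension of the tangent space to the cone over the Chow variety C_{d,n} at the smooth point x_0⋯x_{d−1}, which decomposes as ⟨p⟩ ⊕ A ⊕ A′ of dimensions 1, d(d−1) and d(n+1−d).) -/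
/-- The family of monomials `∏ α, x (c α)` and `x i * ∏ α ≠ k, x (c α)` with `i ≠ c k`,
given by exponent vectors. -/
noncomputable def tangentExponent {d n : ℕ} (c : Fin d → Fin (n + 1)) :
    Option (Fin d × Fin n) → Fin (n + 1) →₀ ℕ
  | none => ∑ α, Finsupp.single (c α) 1
  | some (k, j) => Finsupp.single ((c k).succAbove j) 1 +
      ∑ α ∈ Finset.univ.filter (fun α : Fin d => α ≠ k), Finsupp.single (c α) 1

theorem single_add_sum_filter_ne {d : ℕ} {σ : Type*} (c : Fin d → σ) (k : Fin d) :
    Finsupp.single (c k) 1 +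
      ∑ α ∈ Finset.univ.filter (fun α : Fin d => α ≠ k), Finsupp.single (c α) 1 =
    ∑ α, Finsupp.single (c α) (1 : ℕ) := by
  rw [Finset.filter_ne', Finset.add_sum_erase _ (fun α => Finsupp.single (c α) 1)
    (Finset.mem_univ k)]

theorem tangentExponent_some_add {d n : ℕ} (c : Fin d → Fin (n + 1)) (k : Fin d) (j : Fin n) :
    tangentExponent c (some (k, j)) + Finsupp.single (c k) 1 =
      tangentExponent c none + Finsupp.single ((c k).succAbove j) 1 := by
  simp only [tangentExponent]
  rw [← single_add_sum_filter_ne c k]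
  abel

theorem tangentExponent_some_ne_none {d n : ℕ} (c : Fin d → Fin (n + 1)) (x : Fin d × Fin n) :
    tangentExponent c (some x) ≠ tangentExponent c none := by
  obtain ⟨k, j⟩ := x
  intro h
  have h' := tangentExponent_some_add c k j
  rw [h, add_right_inj, Finsupp.single_left_inj one_ne_zero] at h'
  exact Fin.succAbove_ne _ _ h'.symm

theorem tangentExponent_injective {d n : ℕ} {c : Fin d → Fin (n + 1)}
    (hc : Function.Injective c) : Function.Injective (tangentExponent c) := by
  rintro (_ | ⟨k, j⟩) (_ | ⟨l, m⟩) h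
  · rfl
  · exact absurd h.symm (tangentExponent_some_ne_none c _)
  · exact absurd h (tangentExponent_some_ne_none c _)
  · have h₁ := tangentExponent_some_add c k j
    have h₂ := tangentExponent_some_add c l m
    have key : Finsupp.single ((c k).succAbove j) 1 + Finsupp.single (c l) 1 =
        Finsupp.single ((c l).succAbove m) 1 + Finsupp.single (c k) (1 : ℕ) := by
      apply add_left_cancel (a := tangentExponent c none)
      rw [← add_assoc, ← h₁, ← add_assoc, ← h₂, h]
      abel
    have hkl : k = l := by
      by_contra hkl
      have := DFunLike.congr_fun key (c l)
      simp [Finsupp.single_apply, hc.eq_iff, hkl] at this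
    subst hkl
    rw [add_left_inj, Finsupp.single_left_inj one_ne_zero] at key
    rw [Fin.succAbove_right_injective key]

theorem range_monomial_tangentExponent {R : Type*} [CommSemiring R] {d n : ℕ}
    (hd : 1 ≤ d) (c : Fin d → Fin (n + 1)) :
    Set.range (fun x => MvPolynomial.monomial (tangentExponent c x) (1 : R)) =
      {q | ∃ k : Fin d, ∃ i : Fin (n + 1), q = MvPolynomial.X i *
        ∏ α ∈ Finset.univ.filter (fun α : Fin d => α ≠ k), MvPolynomial.X (c α)} := by
  have hmon (k : Fin d) (i : Fin (n + 1)) : MvPolynomial.X i *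
      ∏ α ∈ Finset.univ.filter (fun α : Fin d => α ≠ k), MvPolynomial.X (c α) =
      MvPolynomial.monomial (Finsupp.single i 1 +
        ∑ α ∈ Finset.univ.filter (fun α : Fin d => α ≠ k), Finsupp.single (c α) 1) (1 : R) := by
    simp only [MvPolynomial.X]
    rw [← MvPolynomial.monomial_sum_one, MvPolynomial.monomial_mul, one_mul]
  ext q
  simp only [hmon, Set.mem_range, Set.mem_ofPred_eq]
  constructor
  · rintro ⟨_ | ⟨k, j⟩, rfl⟩
    · exact ⟨⟨0, hd⟩, c ⟨0, hd⟩, by rw [single_add_sum_filter_ne, tangentExponent]⟩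
    · exact ⟨k, (c k).succAbove j, rfl⟩
  · rintro ⟨k, i, rfl⟩
    obtain rfl | ⟨j, rfl⟩ := Fin.eq_self_or_eq_succAbove (c k) i
    · exact ⟨none, by rw [single_add_sum_filter_ne, tangentExponent]⟩
    · exact ⟨some (k, j), rfl⟩


/-- The tangent space to the cone over the Chow variety `C_{d,n}` at the smooth point
`x_0 ⋯ x_{d-1}` is spanned by the monomials `x_i · ∏_{α ≠ k} x_α` and has dimension
`d·n + 1`. -/
theorem chow_tangent_space_dim_at_monomial (d n : ℕ) (hd : 1 ≤ d) (hdn : d ≤ n + 1) :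
    Module.finrank ℂ (Submodule.span ℂ
      {q : MvPolynomial (Fin (n + 1)) ℂ | ∃ k : Fin d, ∃ i : Fin (n + 1),
        q = MvPolynomial.X i *
          ∏ α ∈ Finset.univ.filter (fun α : Fin d => α ≠ k),
            MvPolynomial.X (Fin.castLE hdn α)}) = d * n + 1 := by
  rw [← range_monomial_tangentExponent hd, finrank_span_eq_card]
  · simp
  · have h := (MvPolynomial.basisMonomials (Fin (n + 1)) ℂ).linearIndependent.comp _
      (tangentExponent_injective (Fin.castLE_injective hdn))
    rw [MvPolynomial.coe_basisMonomials] at h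
    exact h
end
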